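/- Let N be a positive even integer that is not a power of 2. Then there exists an integer β with 1 ≤ β < N for which no optimal packing for parameters N and β exists. -/

import Mathlib

/-- `C` is an optimal packing for parameters `N` and `β`: the set of client slots `C`
and its translate `C + β` (the server slots) are disjoint and together cover all of
`ZMod N`. -/
def IsOptimalPacking (N : ℕ) (β : ℕ) (C : Set (ZMod N)) : Prop :=
  Disjoint C ((fun c => c + (β : ZMod N)) '' C) ∧
    C ∪ ((fun c => c + (β : ZMod N)) '' C) = Set.univ

/-- Translation by `β` exchanges an optimal packing with its complement. -/
theorem IsOptimalPacking.add_mem_iff {N β : ℕ} {C : Set (ZMod N)}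
    (h : IsOptimalPacking N β C) (x : ZMod N) : x + (β : ZMod N) ∈ C ↔ x ∉ C := by
  constructor
  · intro hxβ hx
    exact Set.disjoint_left.mp h.1 hxβ ⟨x, hx, rfl⟩
  · intro hx
    have hmem : x + (β : ZMod N) ∈ C ∪ (fun c => c + (β : ZMod N)) '' C :=
      h.2 ▸ Set.mem_univ _
    rcases hmem with hC | ⟨c, hc, hcx⟩
    · exact hC
    · exact absurd (add_right_cancel hcx ▸ hc) hx

theorem IsOptimalPacking.natCast_mul_mem_iff {N β : ℕ} {C : Set (ZMod N)}
    (h : IsOptimalPacking N β C) (j : ℕ) :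
    (j : ZMod N) * (β : ZMod N) ∈ C ↔ ((0 : ZMod N) ∈ C ↔ Even j) := by
  induction j with
  | zero => simp
  | succ j ih =>
    rw [Nat.cast_succ, add_one_mul, h.add_mem_iff, ih, Nat.even_add_one]
    tauto

/-- No optimal packing exists when some odd multiple of `β` vanishes modulo `N`. -/
theorem not_isOptimalPacking_of_odd_of_dvd {N β m : ℕ} (hm : Odd m) (hdvd : N ∣ m * β)
    (C : Set (ZMod N)) : ¬ IsOptimalPacking N β C := by
  intro h
  have hiff := h.natCast_mul_mem_iff m
  rw [← Nat.cast_mul, (ZMod.natCast_eq_zero_iff _ _).mpr hdvd] at hiff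
  have hne := Nat.not_even_iff_odd.mpr hm
  tauto

theorem optimal_packing_fails_of_not_pow_two
    (N : ℕ) (hN : 0 < N) (hNe : Even N) (hnp : ¬ ∃ n : ℕ, N = 2 ^ n) :
    ∃ β : ℕ, 1 ≤ β ∧ β < N ∧ ¬ ∃ C : Set (ZMod N), IsOptimalPacking N β C := by
  obtain ⟨k, m, hm, rfl⟩ := Nat.exists_eq_two_pow_mul_odd hN.ne'
  have hm1 : 1 < m := by
    have hne : m ≠ 1 := fun h => hnp ⟨k, by rw [h, mul_one]⟩
    have := hm.pos
    omega
  refine ⟨2 ^ k, Nat.one_le_two_pow, lt_mul_of_one_lt_right (by positivity) hm1, ?_⟩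
  rintro ⟨C, hC⟩
  exact not_isOptimalPacking_of_odd_of_dvd hm (mul_comm m (2 ^ k)).symm.dvd C hC
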